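/- arXiv:1702.08837 — 5 statements merged into one kernel-verified Lean document; each statement's English description precedes it below -/
import Mathlib

section
/- Let ω : M → L and ε : L → M be linear maps such that id_M − ε∘ω is bijective, and set ω_ε := ω ∘ (id_M − ε∘ω)^{-1} : M → L. Then {u + ω(u) : u ∈ M} = {v + ω_ε(v) + ε(ω_ε(v)) : v ∈ M}; that is, the graph of ω over the splitting (M, L) coincides with the graph of ω_ε over the splitting (M, L_ε), where L_ε = {x + ε(x) : x ∈ L}. (This is the paper's key formula ω_ε = ω(1 − εω)^{-1} describing the same deformation M' of M with respect to the two transversals L and L_ε.) -/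
/-- If `id_M - ε∘ω` is bijective and `ω_ε := ω ∘ (id_M - ε∘ω)⁻¹`, then the
graph of `ω` over the splitting `(M, L)` coincides with the graph of `ω_ε` over the
splitting `(M, L_ε)`, i.e. `{u + ω u} = {v + ω_ε v + ε (ω_ε v)}`. -/
theorem statement3 {k V : Type*} [Field k] [AddCommGroup V] [Module k V]
    (M L : Submodule k V) (hcompl : IsCompl M L)
    (ω : M →ₗ[k] L) (ε : L →ₗ[k] M)
    (h : Function.Bijective (LinearMap.id - ε ∘ₗ ω : M →ₗ[k] M))
    (ωε : M →ₗ[k] L)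
    (hωε : ωε = ω ∘ₗ (LinearEquiv.ofBijective (LinearMap.id - ε ∘ₗ ω) h).symm.toLinearMap) :
    (Set.range fun u : M => (u : V) + (ω u : V)) =
      (Set.range fun v : M => (v : V) + (ωε v : V) + (ε (ωε v) : V)) := by
  have hωε_apply (u : M) : ωε ((LinearMap.id - ε ∘ₗ ω : M →ₗ[k] M) u) = ω u := by
    rw [hωε]
    exact congrArg ω
      ((LinearEquiv.ofBijective (LinearMap.id - ε ∘ₗ ω : M →ₗ[k] M) h).symm_apply_apply u)
  rw [← h.surjective.range_comp fun v : M => (v : V) + (ωε v : V) + (ε (ωε v) : V)]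
  congr 1
  funext u
  simp only [Function.comp_apply, hωε_apply]
  simp only [LinearMap.sub_apply, LinearMap.id_apply, LinearMap.comp_apply, Submodule.coe_sub]
  abel
end

section
/- For linear maps ω : M → L and ε : L → M, one has V = graph(ω) ⊕ graph(ε) (internal direct sum) if and only if id_M − ε∘ω is bijective. (This is the paper's transversality criterion: the deformation M' = graph(ω) of M is transverse to the deformation L_ε = graph(ε) of L exactly when 1 − εω is invertible.) -/
/-- Components along complementary submodules are unique. -/
theorem Submodule.eq_and_eq_of_coe_add_coe_eq {R V : Type*} [Ring R] [AddCommGroup V]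
    [Module R V] {M L : Submodule R V} (h : Disjoint M L) {m m' : M} {l l' : L}
    (e : (m : V) + l = m' + l') : m = m' ∧ l = l' := by
  have hsub : (m : V) - m' = l' - l := by
    rw [sub_eq_sub_iff_add_eq_add, e, add_comm]
  have hm : (m : V) - m' = 0 := Submodule.disjoint_def.1 h _ (M.sub_mem m.2 m'.2)
    (hsub ▸ L.sub_mem l'.2 l.2)
  have hl : (l' : V) - l = 0 := hsub ▸ hm
  exact ⟨Subtype.ext (sub_eq_zero.1 hm), Subtype.ext (sub_eq_zero.1 hl).symm⟩

/-- For linear maps `ω : M → L` and `ε : L → M`,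
`V = graph(ω) ⊕ graph(ε)` if and only if `id_M - ε∘ω` is bijective. -/
theorem statement4 {k V : Type*} [Field k] [AddCommGroup V] [Module k V]
    (M L : Submodule k V) (hcompl : IsCompl M L)
    (ω : M →ₗ[k] L) (ε : L →ₗ[k] M) :
    IsCompl (LinearMap.range (M.subtype + L.subtype ∘ₗ ω))
        (LinearMap.range (L.subtype + M.subtype ∘ₗ ε)) ↔
      Function.Bijective (LinearMap.id - ε ∘ₗ ω : M →ₗ[k] M) := by
  have add_eq_iff {m m' : M} {l l' : L} (e : (m : V) + l = m' + l') :=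
    Submodule.eq_and_eq_of_coe_add_coe_eq hcompl.disjoint e
  constructor
  · intro h
    refine ⟨(injective_iff_map_eq_zero _).2 fun m hm => ?_, fun m => ?_⟩
    · have hm' : m = ε (ω m) := sub_eq_zero.1 hm
      have hz : (m : V) + ω m = 0 := Submodule.disjoint_def.1 h.disjoint _ ⟨m, rfl⟩
        ⟨ω m, by simp [← hm', add_comm]⟩
      exact (add_eq_iff (m' := 0) (l' := 0) (by simpa using hz)).1
    · obtain ⟨_, ⟨u, rfl⟩, _, ⟨x, rfl⟩, e⟩ :=
        Submodule.mem_sup.1 (h.sup_eq_top ▸ Submodule.mem_top : (m : V) ∈ _ ⊔ _)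
      obtain ⟨h₁, h₂⟩ := add_eq_iff (m := u + ε x) (l := ω u + x) (m' := m) (l' := 0) (by
        simp only [LinearMap.add_apply, LinearMap.comp_apply, Submodule.subtype_apply] at e
        push_cast
        rw [add_zero, ← e]
        abel)
      refine ⟨u, ?_⟩
      rw [← h₁, eq_neg_of_add_eq_zero_right h₂]
      simp [sub_eq_add_neg]
  · intro h
    constructor
    · rw [Submodule.disjoint_def]
      rintro _ ⟨u, rfl⟩ ⟨x, e⟩
      obtain ⟨h₁, h₂⟩ := add_eq_iff (m := ε x) (l := x) (m' := u) (l' := ω u) (by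
        simpa [add_comm] using e)
      have hu : u = 0 := (injective_iff_map_eq_zero _).1 h.1 u (by simp [← h₂, h₁])
      simp [hu]
    · rw [codisjoint_iff, Submodule.eq_top_iff']
      intro v
      obtain ⟨m, hm, l, hl, rfl⟩ :=
        Submodule.mem_sup.1 (hcompl.sup_eq_top ▸ Submodule.mem_top : v ∈ M ⊔ L)
      lift m to M using hm
      lift l to L using hl
      obtain ⟨u, hu⟩ := h.2 (m - ε l)
      have hu' : u - ε (ω u) = m - ε l := hu
      have hm : m = u + ε (l - ω u) := by
        rw [map_sub, add_sub_left_comm, hu']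
        abel
      refine Submodule.mem_sup.2 ⟨_, ⟨u, rfl⟩, _, ⟨l - ω u, rfl⟩, ?_⟩
      conv_rhs => rw [hm]
      simp only [LinearMap.add_apply, LinearMap.comp_apply, Submodule.subtype_apply]
      push_cast
      abel
end

section
/- Let W be a finite-dimensional vector space over a field k, let ω : W → W* be a linear map with ω(u)(v) = −ω(v)(u) for all u, v ∈ W, and let ε : W* → W be a linear map with ξ(ε(η)) = −η(ε(ξ)) for all ξ, η ∈ W*. If id_W − ε∘ω is bijective, then ω' := ω ∘ (id_W − ε∘ω)^{-1} again satisfies ω'(u)(v) = −ω'(v)(u) for all u, v ∈ W. (The gauge transformation ω ↦ ω(1 − εω)^{-1} of the paper preserves skewness, i.e. it sends Lagrangian graphs to Lagrangian graphs.) -/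
/-- The gauge transformation `ω ↦ ω ∘ (id - ε∘ω)⁻¹` preserves skewness:
if `ω : W → W*` and `ε : W* → W` are skew and `id_W - ε∘ω` is bijective, then
`ω' := ω ∘ (id_W - ε∘ω)⁻¹` is again skew. -/
theorem statement5 {k W : Type*} [Field k] [AddCommGroup W] [Module k W]
    [FiniteDimensional k W]
    (ω : W →ₗ[k] Module.Dual k W) (hω : ∀ u v : W, ω u v = -ω v u)
    (ε : Module.Dual k W →ₗ[k] W) (hε : ∀ ξ η : Module.Dual k W, ξ (ε η) = -η (ε ξ))
    (h : Function.Bijective (LinearMap.id - ε ∘ₗ ω : W →ₗ[k] W))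
    (ω' : W →ₗ[k] Module.Dual k W)
    (hω' : ω' = ω ∘ₗ (LinearEquiv.ofBijective (LinearMap.id - ε ∘ₗ ω) h).symm.toLinearMap) :
    ∀ u v : W, ω' u v = -ω' v u := by
  have key : ∀ a, ω' ((LinearMap.id - ε ∘ₗ ω : W →ₗ[k] W) a) = ω a := fun a => by
    rw [hω', LinearMap.comp_apply]
    exact congrArg ω ((LinearEquiv.ofBijective (LinearMap.id - ε ∘ₗ ω) h).symm_apply_apply a)
  intro u v
  obtain ⟨a, rfl⟩ := h.surjective u
  obtain ⟨b, rfl⟩ := h.surjective v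
  rw [key, key]
  simp only [LinearMap.sub_apply, LinearMap.id_apply, LinearMap.comp_apply, map_sub]
  rw [hω a b, hε (ω a) (ω b)]
  ring
end

section
/- Let W be a finite-dimensional vector space over a field, let k ≥ 0, and let D be a linear endomorphism of Λ(W) such that for all f₀, …, f_k ∈ W* the iterated commutator [⋯[[D, ι_{f₀}], ι_{f₁}], …, ι_{f_k}] of linear endomorphisms of Λ(W) vanishes. Then for every j ≥ 0, D maps Λ^j(W) into ⊕_{i ≤ j+k} Λ^i(W). (An operator of order ≤ k with respect to the contraction operators raises degree by at most k; this is the key claim proved inside Lemma 3.1 of the paper, which trades degree of the graded pieces of d_H for order of differential operator.) -/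
/-- The iterated commutator `[⋯[[D, A₀], A₁], …, A_n]` of an endomorphism `D`
with a list of endomorphisms `[A₀, A₁, …, A_n]`. -/
def iteratedComm {R A : Type*} [CommRing R] [AddCommGroup A] [Module R A]
    (D : Module.End R A) (l : List (Module.End R A)) : Module.End R A :=
  l.foldl (fun X Y => X * Y - Y * X) D

open ExteriorAlgebra CliffordAlgebra in
/-- A rank-one perturbation `p + f ⊗ w` of a linear map `p` changes the induced map on exterior
algebras by contraction with `f` followed by multiplication by `w`. -/
theorem ExteriorAlgebra.map_add_smulRight {R M N : Type*} [CommRing R] [AddCommGroup M]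
    [Module R M] [AddCommGroup N] [Module R N] (p : M →ₗ[R] N) (f : Module.Dual R M) (w : N)
    (x : ExteriorAlgebra R M) :
    ExteriorAlgebra.map (p + f.smulRight w) x =
      ExteriorAlgebra.map p x +
        ExteriorAlgebra.ι R w *
          ExteriorAlgebra.map p (contractLeft (Q := (0 : QuadraticForm R M)) f x) := by
  induction x using CliffordAlgebra.left_induction with
  | algebraMap r =>
    rw [contractLeft_algebraMap, map_zero, mul_zero, add_zero]
    exact ((ExteriorAlgebra.map (p + f.smulRight w)).commutes r).trans
      ((ExteriorAlgebra.map p).commutes r).symm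
  | add x y hx hy =>
    simp only [map_add, mul_add, hx, hy]
    abel
  | ι_mul x v hx =>
    have hv (q : M →ₗ[R] N) : ExteriorAlgebra.map q (CliffordAlgebra.ι 0 v * x) =
        ExteriorAlgebra.ι R (q v) * ExteriorAlgebra.map q x := by
      rw [← ExteriorAlgebra.map_apply_ι, ← map_mul]
    have hv' (y : ExteriorAlgebra R M) : ExteriorAlgebra.map p (CliffordAlgebra.ι 0 v * y) =
        ExteriorAlgebra.ι R (p v) * ExteriorAlgebra.map p y := by
      rw [← ExteriorAlgebra.map_apply_ι, ← map_mul]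
    rw [hv, hv, hx, contractLeft_ι_mul]
    erw [map_sub, hv', map_smul]
    have hsw := eq_neg_of_add_eq_zero_left (ExteriorAlgebra.ι_add_mul_swap (R := R) (p v) w)
    simp only [LinearMap.add_apply, LinearMap.smulRight_apply, map_add, map_smul, add_mul, mul_add,
      mul_sub, smul_mul_assoc, mul_smul_comm, ← mul_assoc, hsw, ExteriorAlgebra.ι_sq_zero,
      zero_mul, smul_zero, neg_mul]
    abel

namespace ExteriorAlgebra

variable {R M N : Type*} [CommRing R] [AddCommGroup M] [Module R M] [AddCommGroup N] [Module R N]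

/-- The sum of the exterior powers of degree less than `m`. -/
def degreeLT (R M : Type*) [CommRing R] [AddCommGroup M] [Module R M] (m : ℕ) :
    Submodule R (ExteriorAlgebra R M) :=
  ⨆ i ∈ Finset.range m, (LinearMap.range (ι R : M →ₗ[R] ExteriorAlgebra R M)) ^ i

theorem pow_le_degreeLT {i m : ℕ} (h : i < m) : ⋀[R]^i M ≤ degreeLT R M m :=
  le_iSup₂_of_le i (Finset.mem_range.mpr h) le_rfl

theorem degreeLT_le {m : ℕ} {S : Submodule R (ExteriorAlgebra R M)}
    (h : ∀ i < m, ⋀[R]^i M ≤ S) : degreeLT R M m ≤ S :=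
  iSup₂_le fun i hi => h i (Finset.mem_range.mp hi)

theorem map_mem_exteriorPower (p : M →ₗ[R] N) {i : ℕ} {x : ExteriorAlgebra R M}
    (hx : x ∈ ⋀[R]^i M) : map p x ∈ ⋀[R]^i N := by
  have h : (⋀[R]^i M).map (map p).toLinearMap ≤ ⋀[R]^i N := by
    rw [Submodule.map_pow]
    refine pow_le_pow_left' ?_ i
    rintro _ ⟨_, ⟨v, rfl⟩, rfl⟩
    exact ⟨p v, (map_apply_ι p v).symm⟩
  exact h ⟨x, hx, rfl⟩

theorem ι_mul_map_mem_degreeLT (p : M →ₗ[R] N) (w : N) {m : ℕ} {x : ExteriorAlgebra R M}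
    (hx : x ∈ degreeLT R M m) : ι R w * map p x ∈ degreeLT R N (m + 1) := by
  have h : degreeLT R M m ≤ (degreeLT R N (m + 1)).comap
      (LinearMap.mulLeft R (ι R w) ∘ₗ (map p).toLinearMap) := by
    refine degreeLT_le fun i hi y hy => pow_le_degreeLT (Nat.succ_lt_succ hi) ?_
    change ι R w * map p y ∈ _
    rw [exteriorPower, pow_succ']
    exact Submodule.mul_mem_mul ⟨w, rfl⟩ (map_mem_exteriorPower p hy)
  exact h hx

theorem contractLeft_exteriorPower_zero (f : Module.Dual R M) {x : ExteriorAlgebra R M}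
    (hx : x ∈ ⋀[R]^0 M) : CliffordAlgebra.contractLeft (Q := (0 : QuadraticForm R M)) f x = 0 := by
  rw [exteriorPower, pow_zero] at hx
  obtain ⟨r, rfl⟩ := Submodule.mem_one.mp hx
  exact CliffordAlgebra.contractLeft_algebraMap _ f r

theorem contractLeft_mem_exteriorPower (f : Module.Dual R M) {i : ℕ} {x : ExteriorAlgebra R M}
    (hx : x ∈ ⋀[R]^(i + 1) M) :
    CliffordAlgebra.contractLeft (Q := (0 : QuadraticForm R M)) f x ∈ ⋀[R]^i M := by
  induction i generalizing x with
  | zero =>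
    rw [exteriorPower, zero_add, pow_one] at hx
    obtain ⟨v, rfl⟩ := hx
    rw [exteriorPower, pow_zero]
    exact Submodule.mem_one.mpr ⟨f v, (CliffordAlgebra.contractLeft_ι _ f v).symm⟩
  | succ i ih =>
    rw [exteriorPower, pow_succ'] at hx
    induction hx using Submodule.mul_induction_on' with
    | mem_mul_mem a ha b hb =>
      obtain ⟨v, rfl⟩ := ha
      have hc := CliffordAlgebra.contractLeft_ι_mul (Q := (0 : QuadraticForm R M)) (d := f) v b
      refine hc ▸ Submodule.sub_mem _ (Submodule.smul_mem _ _ hb) ?_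
      rw [exteriorPower, pow_succ']
      exact Submodule.mul_mem_mul ⟨v, rfl⟩ (ih hb)
    | add a _ b _ ha hb =>
      rw [map_add]
      exact Submodule.add_mem _ ha hb

theorem map_zero_mem_exteriorPower_zero (x : ExteriorAlgebra R M) :
    map (0 : M →ₗ[R] N) x ∈ ⋀[R]^0 N := by
  rw [exteriorPower, pow_zero]
  induction x using ExteriorAlgebra.induction with
  | algebraMap r => exact Submodule.mem_one.mpr ⟨r, (AlgHom.commutes _ r).symm⟩
  | ι v => simp
  | mul a b ha hb =>
    rw [map_mul, ← one_mul (1 : Submodule R (ExteriorAlgebra R N))]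
    exact Submodule.mul_mem_mul ha hb
  | add a b ha hb =>
    rw [map_add]
    exact Submodule.add_mem _ ha hb

/-- Over a finite free module, an element all of whose contractions have degree less than `m` has
degree less than `m + 1`. -/
theorem mem_degreeLT_succ_of_contractLeft [Module.Free R M] [Module.Finite R M] {m : ℕ}
    {x : ExteriorAlgebra R M}
    (hx : ∀ f : Module.Dual R M,
      CliffordAlgebra.contractLeft (Q := (0 : QuadraticForm R M)) f x ∈ degreeLT R M m) :
    x ∈ degreeLT R M (m + 1) := by
  classical
  let b := Module.Free.chooseBasis R M
  have hs (s : Finset (Module.Free.ChooseBasisIndex R M)) :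
      map (∑ i ∈ s, (b.coord i).smulRight (b i)) x ∈ degreeLT R M (m + 1) := by
    induction s using Finset.induction_on with
    | empty =>
      refine pow_le_degreeLT m.succ_pos ?_
      rw [Finset.sum_empty]
      exact map_zero_mem_exteriorPower_zero x
    | insert a s ha ih =>
      rw [Finset.sum_insert ha, add_comm ((b.coord a).smulRight _), map_add_smulRight]
      exact Submodule.add_mem _ ih (ι_mul_map_mem_degreeLT _ _ (hx _))
  have hid : ∑ i, (b.coord i).smulRight (b i) = LinearMap.id := by
    ext v
    simp
  simpa [hid, map_id] using hs Finset.univ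

/-- An endomorphism whose `n`-fold iterated commutators with contractions vanish raises the
exterior degree by less than `n`. -/
theorem apply_mem_degreeLT_of_iteratedComm_eq_zero [Module.Free R M] [Module.Finite R M] (n : ℕ)
    (D : Module.End R (ExteriorAlgebra R M))
    (hD : ∀ f : Fin n → Module.Dual R M,
      iteratedComm D ((List.ofFn f).map fun φ =>
        (CliffordAlgebra.contractLeft φ : Module.End R (ExteriorAlgebra R M))) = 0)
    (j : ℕ) {x : ExteriorAlgebra R M} (hx : x ∈ ⋀[R]^j M) : D x ∈ degreeLT R M (j + n) := by
  induction n generalizing D j x with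
  | zero =>
    have h0 : D = 0 := by simpa [iteratedComm] using hD Fin.elim0
    simp [h0]
  | succ n ihn =>
    have hcomm (f : Module.Dual R M) {j : ℕ} {x : ExteriorAlgebra R M} (hx : x ∈ ⋀[R]^j M) :
        D (CliffordAlgebra.contractLeft (Q := (0 : QuadraticForm R M)) f x) -
          CliffordAlgebra.contractLeft (Q := (0 : QuadraticForm R M)) f (D x) ∈
            degreeLT R M (j + n) := by
      refine ihn (D * CliffordAlgebra.contractLeft f - CliffordAlgebra.contractLeft f * D)
        (fun g => ?_) j hx
      simpa [iteratedComm, List.ofFn_succ] using hD (Fin.cons f g)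
    induction j generalizing x with
    | zero =>
      refine mem_degreeLT_succ_of_contractLeft fun f => ?_
      have h := hcomm f hx
      rw [contractLeft_exteriorPower_zero f hx, map_zero, zero_sub] at h
      exact neg_mem_iff.mp h
    | succ j ihj =>
      refine mem_degreeLT_succ_of_contractLeft fun f => ?_
      have h := ihj (contractLeft_mem_exteriorPower f hx)
      rw [← add_assoc, add_right_comm] at h
      exact (Submodule.sub_mem_iff_right _ h).mp (hcomm f hx)

end ExteriorAlgebra

/-- If `D : Λ(W) → Λ(W)` satisfies
`[⋯[[D, ι_{f₀}], ι_{f₁}], …, ι_{f_k}] = 0` for all `f₀, …, f_k ∈ W*` (i.e. `D` is a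
differential operator of order ≤ k with respect to the contraction operators), then
`D` raises the exterior degree by at most `k`: `D (Λ^j W) ⊆ ⊕_{i ≤ j+k} Λ^i W`. -/
theorem statement11 {k : Type*} [Field k] {W : Type*} [AddCommGroup W] [Module k W]
    [FiniteDimensional k W] (n : ℕ)
    (D : Module.End k (ExteriorAlgebra k W))
    (hD : ∀ f : Fin (n + 1) → Module.Dual k W,
      iteratedComm D ((List.ofFn f).map fun φ =>
        (CliffordAlgebra.contractLeft φ : Module.End k (ExteriorAlgebra k W))) = 0) :
    ∀ j : ℕ, ∀ x ∈ (LinearMap.range (ExteriorAlgebra.ι k : W →ₗ[k] ExteriorAlgebra k W)) ^ j,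
      D x ∈ ⨆ i ∈ Finset.range (j + n + 1),
        (LinearMap.range (ExteriorAlgebra.ι k : W →ₗ[k] ExteriorAlgebra k W)) ^ i := by
  exact fun j x hx =>
    ExteriorAlgebra.apply_mem_degreeLT_of_iteratedComm_eq_zero (n + 1) D hD j hx
end

section
/- Let Φ : M → L and Φ̄ : L → M be linear maps such that id_L − Φ∘Φ̄ is bijective, and set M^Φ := {u + Φ(u) : u ∈ M} and L^Φ̄ := {x + Φ̄(x) : x ∈ L}. Then the assignment x + Φ̄(x) ↦ −(Φ̄(x) + Φ(Φ̄(x))) is a well-defined linear map Υ : L^Φ̄ → M^Φ, and {w + Υ(w) : w ∈ L^Φ̄} = L; that is, the original subspace L is the graph of Υ over the deformed splitting (M^Φ, L^Φ̄). (This is the linear-algebra computation of the map Ῡ with L = graph(Ῡ : L^φ → M^φ) used in the proof of Theorem 5.10 of the paper on the Kodaira–Spencer complex of a deformed complex structure.) -/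
/-- Given `Φ : M → L`, `Φ̄ : L → M` with `id_L − Φ∘Φ̄` bijective, and the
deformed subspaces `M^Φ = {u + Φ u}`, `L^Φ̄ = {x + Φ̄ x}`, the assignment
`x + Φ̄ x ↦ −(Φ̄ x + Φ(Φ̄ x))` is a well-defined linear map `Υ : L^Φ̄ → M^Φ`, and the
graph `{w + Υ w : w ∈ L^Φ̄}` equals the original subspace `L`. -/
theorem statement18 {k V : Type*} [Field k] [AddCommGroup V] [Module k V]
    (M L : Submodule k V) (hcompl : IsCompl M L)
    (Φ : M →ₗ[k] L) (Φbar : L →ₗ[k] M)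
    (h : Function.Bijective (LinearMap.id - Φ ∘ₗ Φbar : L →ₗ[k] L))
    (MΦ LΦbar : Submodule k V)
    (hMΦ : MΦ = LinearMap.range (M.subtype + L.subtype ∘ₗ Φ))
    (hLΦbar : LΦbar = LinearMap.range (L.subtype + M.subtype ∘ₗ Φbar)) :
    ∃ Υ : LΦbar →ₗ[k] V,
      (∀ w : LΦbar, Υ w ∈ MΦ) ∧
      (∀ (x : L) (w : LΦbar), (w : V) = (x : V) + (Φbar x : V) →
        Υ w = -((Φbar x : V) + (Φ (Φbar x) : V))) ∧
      (Set.range fun w : LΦbar => (w : V) + Υ w) = (L : Set V) := by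
  subst hMΦ hLΦbar
  set P : V →ₗ[k] L := L.projectionOnto M hcompl.symm with hP
  have hproj (x : L) : P ((x : V) + (Φbar x : V)) = x := by
    rw [hP, map_add, Submodule.projectionOnto_apply_left, Submodule.projectionOnto_apply_right,
      add_zero]
  refine ⟨-((M.subtype + L.subtype ∘ₗ Φ) ∘ₗ Φbar ∘ₗ P ∘ₗ Submodule.subtype _), ?_, ?_, ?_⟩
  · exact fun w => neg_mem ⟨Φbar (P w), rfl⟩
  · intro x w hw
    simp [hw, hproj]
  · ext v
    constructor
    · rintro ⟨⟨_, x, rfl⟩, rfl⟩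
      rw [SetLike.mem_coe]
      convert (x - Φ (Φbar x)).2 using 1
      simp only [LinearMap.neg_apply, LinearMap.comp_apply, LinearMap.add_apply,
        Submodule.subtype_apply, hproj, Submodule.coe_sub]
      abel
    · intro hv
      obtain ⟨x, hx⟩ := h.2 ⟨v, hv⟩
      have hxv : (x : V) - Φ (Φbar x) = v := congrArg Subtype.val hx
      refine ⟨⟨_, x, rfl⟩, ?_⟩
      simp only [LinearMap.neg_apply, LinearMap.comp_apply, LinearMap.add_apply,
        Submodule.subtype_apply, hproj]
      rw [← hxv]
      abel
end
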